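/- There exist no real numbers a, τ and ω > 0 such that both ω = a·sin(ωτ) and 2ω = a·sin(2ωτ) hold. -/

import Mathlib

/-- No 2:1 strong resonance: there are no reals `a`, `τ` and `ω > 0` with
`ω = a·sin(ωτ)` and `2ω = a·sin(2ωτ)`. -/
theorem no_two_one_resonance :
    ¬ ∃ (a τ ω : ℝ), 0 < ω ∧ ω = a * Real.sin (ω * τ) ∧
      2 * ω = a * Real.sin (2 * ω * τ) := by
  rintro ⟨a, τ, ω, hω, h₁, h₂⟩
  rw [mul_assoc 2 ω τ, Real.sin_two_mul] at h₂
  have hcos : Real.cos (ω * τ) = 1 := by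
    apply mul_left_cancel₀ hω.ne'
    linear_combination Real.cos (ω * τ) * h₁ - h₂ / 2
  have hsin : Real.sin (ω * τ) = 0 := by
    have h := Real.sin_sq_add_cos_sq (ω * τ)
    rw [hcos] at h
    exact pow_eq_zero_iff two_ne_zero |>.mp (by linarith)
  rw [hsin, mul_zero] at h₁
  exact hω.ne' h₁
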